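/- Let X be a proper Busemann space, x₀ ∈ X, and let φ : X → ℝ be a horofunction based at x₀ with φ(x₀) = 0. Then there exists a unique ray c : [0,∞) → X with c(0) = x₀ such that for every t > 0 one has φ(c(t)) = −t, and c(t) is the unique minimizer of φ on the closed ball of radius t about x₀: for every y with d(x₀,y) ≤ t and y ≠ c(t), φ(y) > −t. -/

import Mathlib

open Filter

/-- A geodesic from `x` to `y`: a map `γ : ℝ → X` (restricted to `[0,1]`) with
`γ 0 = x`, `γ 1 = y` and `dist (γ s) (γ t) = |s - t| * dist x y` for `s, t ∈ [0,1]`. -/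
def IsGeodesicSeg {X : Type*} [MetricSpace X] (γ : ℝ → X) (x y : X) : Prop :=
  γ 0 = x ∧ γ 1 = y ∧
    ∀ s ∈ Set.Icc (0 : ℝ) 1, ∀ t ∈ Set.Icc (0 : ℝ) 1,
      dist (γ s) (γ t) = |s - t| * dist x y

/-- A Busemann space: every pair of points is joined by a geodesic, and for any two
geodesics starting at the same point, `dist (γ₁ t) (γ₂ t) ≤ t * dist (γ₁ 1) (γ₂ 1)`. -/
def IsBusemannSpace (X : Type*) [MetricSpace X] : Prop :=
  (∀ x y : X, ∃ γ : ℝ → X, IsGeodesicSeg γ x y) ∧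
    ∀ (γ₁ γ₂ : ℝ → X) (x y₁ y₂ : X), IsGeodesicSeg γ₁ x y₁ → IsGeodesicSeg γ₂ x y₂ →
      ∀ t ∈ Set.Icc (0 : ℝ) 1, dist (γ₁ t) (γ₂ t) ≤ t * dist y₁ y₂

/-- A ray: `c : ℝ → X` (restricted to `[0,∞)`) with `dist (c s) (c t) = |s - t|`. -/
def IsRay {X : Type*} [MetricSpace X] (c : ℝ → X) : Prop :=
  ∀ s t : ℝ, 0 ≤ s → 0 ≤ t → dist (c s) (c t) = |s - t|

/-- A horofunction based at `x₀`: a pointwise limit of the normalized distance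
functions `y ↦ dist y x_k - dist x₀ x_k` along a sequence with `dist x₀ x_k → ∞`. -/
def IsHorofunction {X : Type*} [MetricSpace X] (x₀ : X) (φ : X → ℝ) : Prop :=
  ∃ x : ℕ → X, Tendsto (fun k => dist x₀ (x k)) atTop atTop ∧
    ∀ y : X, Tendsto (fun k => dist y (x k) - dist x₀ (x k)) atTop (nhds (φ y))

section Busemann

variable {X : Type*} [MetricSpace X]

lemma IsGeodesicSeg.dist_left {γ : ℝ → X} {x y : X} (h : IsGeodesicSeg γ x y) {t : ℝ}
    (ht : t ∈ Set.Icc (0 : ℝ) 1) : dist x (γ t) = t * dist x y := by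
  have h1 := h.2.2 0 (by simp) t ht
  rwa [h.1, zero_sub, abs_neg, abs_of_nonneg ht.1] at h1

lemma IsGeodesicSeg.dist_right {γ : ℝ → X} {x y : X} (h : IsGeodesicSeg γ x y) {t : ℝ}
    (ht : t ∈ Set.Icc (0 : ℝ) 1) : dist (γ t) y = (1 - t) * dist x y := by
  have h1 := h.2.2 t ht 1 (by simp)
  rwa [h.2.1, abs_sub_comm, abs_of_nonneg (by linarith [ht.2])] at h1

lemma IsGeodesicSeg.reverse {γ : ℝ → X} {x y : X} (h : IsGeodesicSeg γ x y) :
    IsGeodesicSeg (fun t => γ (1 - t)) y x := by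
  refine ⟨by simp [h.2.1], by simp [h.1], fun s hs t ht => ?_⟩
  have h1 := h.2.2 (1 - s) ⟨by linarith [hs.2], by linarith [hs.1]⟩
    (1 - t) ⟨by linarith [ht.2], by linarith [ht.1]⟩
  rw [h1, abs_sub_comm, dist_comm x y]
  congr 2
  ring

/-- Every metric midpoint of `x` and `y` is the midpoint of some geodesic from `x` to `y`. -/
lemma IsBusemannSpace.exists_geodesic_through_midpoint (hX : IsBusemannSpace X) {x y m : X}
    (h1 : dist x m = dist x y / 2) (h2 : dist m y = dist x y / 2) :
    ∃ γ : ℝ → X, IsGeodesicSeg γ x y ∧ γ (1 / 2) = m := by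
  obtain ⟨α, hα⟩ := hX.1 x m
  obtain ⟨β, hβ⟩ := hX.1 m y
  set γ : ℝ → X := fun t => if t ≤ 1 / 2 then α (2 * t) else β (2 * t - 1) with hγ
  have key : ∀ s ∈ Set.Icc (0 : ℝ) 1, ∀ t ∈ Set.Icc (0 : ℝ) 1, s ≤ t →
      dist (γ s) (γ t) = (t - s) * dist x y := by
    rintro s ⟨hs0, hs1⟩ t ⟨ht0, ht1⟩ hst
    by_cases ht : t ≤ 1 / 2
    · have hs : s ≤ 1 / 2 := hst.trans ht
      simp only [hγ, if_pos hs, if_pos ht]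
      rw [hα.2.2 _ ⟨by linarith, by linarith⟩ _ ⟨by linarith, by linarith⟩, abs_sub_comm,
        abs_of_nonneg (by linarith), h1]
      ring
    · have ht' : 2 * t - 1 ∈ Set.Icc (0 : ℝ) 1 := ⟨by linarith, by linarith⟩
      by_cases hs : s ≤ 1 / 2
      · have hs' : 2 * s ∈ Set.Icc (0 : ℝ) 1 := ⟨by linarith, by linarith⟩
        simp only [hγ, if_pos hs, if_neg ht]
        have a1 := hα.dist_left hs'
        have a2 := hα.dist_right hs'
        have b1 := hβ.dist_left ht'
        have b2 := hβ.dist_right ht'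
        rw [h1] at a1 a2
        rw [h2] at b1 b2
        have t1 := dist_triangle (α (2 * s)) m (β (2 * t - 1))
        have t2 := dist_triangle4 x (α (2 * s)) (β (2 * t - 1)) y
        apply le_antisymm <;> linarith
      · simp only [hγ, if_neg hs, if_neg ht]
        rw [hβ.2.2 _ ⟨by linarith, by linarith⟩ _ ht', abs_sub_comm,
          abs_of_nonneg (by linarith), h2]
        ring
  refine ⟨γ, ⟨?_, ?_, fun s hs t ht => ?_⟩, ?_⟩
  · simp [hγ, hα.1]
  · norm_num [hγ, hβ.2.1]
  · rcases le_total s t with h | h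
    · rw [key s hs t ht h, abs_sub_comm, abs_of_nonneg (by linarith)]
    · rw [dist_comm, key t ht s hs h, abs_of_nonneg (by linarith)]
  · simp [hγ, hα.2.1]

lemma IsBusemannSpace.midpoint_unique (hX : IsBusemannSpace X) {x y m m' : X}
    (h1 : dist x m = dist x y / 2) (h2 : dist m y = dist x y / 2)
    (h1' : dist x m' = dist x y / 2) (h2' : dist m' y = dist x y / 2) : m = m' := by
  obtain ⟨γ, hγ, rfl⟩ := hX.exists_geodesic_through_midpoint h1 h2
  obtain ⟨γ', hγ', rfl⟩ := hX.exists_geodesic_through_midpoint h1' h2'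
  have h := hX.2 γ γ' x y y hγ hγ' (1 / 2) (by norm_num)
  rw [dist_self, mul_zero] at h
  exact dist_le_zero.1 h

lemma half_mem_Icc : (1 / 2 : ℝ) ∈ Set.Icc (0 : ℝ) 1 := by norm_num

lemma IsBusemannSpace.dist_midpoint_le (hX : IsBusemannSpace X) {η : ℝ → X} {p q : X}
    (hη : IsGeodesicSeg η p q) (x : X) :
    dist (η (1 / 2)) x ≤ (dist p x + dist q x) / 2 := by
  obtain ⟨α, hα⟩ := hX.1 p x
  have h1 := hX.2 η α p q x hη hα _ half_mem_Icc
  have h2 := hα.dist_right half_mem_Icc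
  have h3 := dist_triangle (η (1 / 2)) (α (1 / 2)) x
  linarith

/-- Balls in a Busemann space are strictly convex. -/
lemma IsBusemannSpace.eq_of_dist_midpoint_eq (hX : IsBusemannSpace X) {η : ℝ → X} {p q x : X}
    (hη : IsGeodesicSeg η p q) {t : ℝ} (hp : dist x p = t) (hq : dist x q = t)
    (hm : dist x (η (1 / 2)) = t) : p = q := by
  have key : ∀ n : ℕ, ∀ (x : X) (t : ℝ), dist x p = t → dist x q = t →
      dist x (η (1 / 2)) = t → dist p q ≤ 2 * t * (1 / 2) ^ n := by
    intro n
    induction n with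
    | zero =>
      intro x t hp hq _
      have := dist_triangle_left p q x
      rw [pow_zero]
      linarith
    | succ n ih =>
      intro x t hp hq hm
      obtain ⟨α, hα⟩ := hX.1 p x
      obtain ⟨β, hβ⟩ := hX.1 q x
      have hu := hX.2 α η p x q hα hη _ half_mem_Icc
      have hv := hX.2 β _ q x p hβ hη.reverse _ half_mem_Icc
      norm_num only at hv
      have a1 := hα.dist_left half_mem_Icc
      have a2 := hα.dist_right half_mem_Icc
      have b1 := hβ.dist_left half_mem_Icc
      have b2 := hβ.dist_right half_mem_Icc
      rw [dist_comm _ x, dist_comm p x, hp] at a2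
      rw [dist_comm _ x, dist_comm q x, hq] at b2
      rw [dist_comm p x, dist_comm p, hp] at a1
      rw [dist_comm q x, dist_comm q, hq] at b1
      rw [hq] at hu
      rw [hp] at hv
      have hu' := dist_triangle x (α (1 / 2)) (η (1 / 2))
      have hv' := dist_triangle x (β (1 / 2)) (η (1 / 2))
      have huv : α (1 / 2) = β (1 / 2) := by
        apply hX.midpoint_unique (x := x) (y := η (1 / 2)) <;> linarith
      have := ih (α (1 / 2)) (t / 2) (by linarith) (by rw [huv]; linarith) (by linarith)
      rw [pow_succ]
      linarith
  have hlim : Tendsto (fun n : ℕ => 2 * t * (1 / 2 : ℝ) ^ n) atTop (nhds (2 * t * 0)) :=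
    (tendsto_pow_atTop_nhds_zero_of_lt_one (by norm_num) (by norm_num)).const_mul _
  have := ge_of_tendsto' hlim fun n => key n x t hp hq hm
  rw [mul_zero] at this
  exact dist_le_zero.1 this

lemma IsBusemannSpace.exists_point_at_dist (hX : IsBusemannSpace X) (x y : X) {s : ℝ}
    (hs : 0 ≤ s) (hsy : s ≤ dist x y) :
    ∃ z : X, dist x z = s ∧ dist z y = dist x y - s := by
  rcases hs.eq_or_lt with rfl | hs
  · exact ⟨x, by simp, by simp⟩
  obtain ⟨γ, hγ⟩ := hX.1 x y
  have hd : 0 < dist x y := hs.trans_le hsy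
  have hmem : s / dist x y ∈ Set.Icc (0 : ℝ) 1 :=
    ⟨by positivity, (div_le_one hd).2 hsy⟩
  refine ⟨γ (s / dist x y), ?_, ?_⟩
  · rw [hγ.dist_left hmem]
    field_simp
  · rw [hγ.dist_right hmem]
    field_simp

lemma IsHorofunction.sub_le_dist {x₀ : X} {φ : X → ℝ} (hφ : IsHorofunction x₀ φ) (y z : X) :
    φ y - φ z ≤ dist y z := by
  obtain ⟨x, -, h⟩ := hφ
  refine le_of_tendsto' ((h y).sub (h z)) fun k => ?_
  linarith [dist_triangle y z (x k)]

lemma IsHorofunction.midpoint_le (hX : IsBusemannSpace X) {x₀ : X} {φ : X → ℝ}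
    (hφ : IsHorofunction x₀ φ) {η : ℝ → X} {p q : X} (hη : IsGeodesicSeg η p q) :
    φ (η (1 / 2)) ≤ (φ p + φ q) / 2 := by
  obtain ⟨x, -, h⟩ := hφ
  refine le_of_tendsto_of_tendsto' (h _) (((h p).add (h q)).div_const 2) fun k => ?_
  linarith [hX.dist_midpoint_le hη (x k)]

lemma IsHorofunction.exists_le_neg [ProperSpace X] (hX : IsBusemannSpace X) {x₀ : X}
    {φ : X → ℝ} (hφ : IsHorofunction x₀ φ) {t : ℝ} (ht : 0 ≤ t) :
    ∃ p : X, dist x₀ p ≤ t ∧ φ p ≤ -t := by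
  obtain ⟨x, hx, h⟩ := hφ
  have hy : ∀ k, ∃ y : X, dist x₀ y ≤ t ∧
      (t ≤ dist x₀ (x k) → dist y (x k) = dist x₀ (x k) - t) := by
    intro k
    by_cases hk : t ≤ dist x₀ (x k)
    · obtain ⟨z, hz, hz'⟩ := hX.exists_point_at_dist x₀ (x k) ht hk
      exact ⟨z, hz.le, fun _ => hz'⟩
    · exact ⟨x₀, by simpa using ht, fun h => absurd h hk⟩
  choose y hy hyx using hy
  obtain ⟨p, hp, ψ, hψ, hlim⟩ := (isCompact_closedBall x₀ t).tendsto_subseq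
    (x := y) fun k => by simpa [dist_comm] using hy k
  refine ⟨p, by simpa [dist_comm] using hp, ?_⟩
  have h1 := (h p).comp hψ.tendsto_atTop
  have h2 : Tendsto (fun k => dist p (y (ψ k)) - t) atTop (nhds (dist p p - t)) :=
    (tendsto_const_nhds.dist hlim).sub_const t
  rw [dist_self, zero_sub] at h2
  refine le_of_tendsto_of_tendsto h1 h2 ?_
  filter_upwards [(hx.comp hψ.tendsto_atTop).eventually_ge_atTop t] with k hk
  have h3 := hyx _ hk
  have h4 := dist_triangle p (y (ψ k)) (x (ψ k))
  simp only [Function.comp_apply]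
  linarith

lemma IsHorofunction.eq_of_le_neg (hX : IsBusemannSpace X) {x₀ : X}
    {φ : X → ℝ} (hφ : IsHorofunction x₀ φ) (hφ0 : φ x₀ = 0) {t : ℝ} {p q : X}
    (hp : dist x₀ p ≤ t) (hp' : φ p ≤ -t) (hq : dist x₀ q ≤ t) (hq' : φ q ≤ -t) : p = q := by
  obtain ⟨η, hη⟩ := hX.1 p q
  have h1 := hφ.midpoint_le hX hη
  have h2 := hX.dist_midpoint_le hη x₀
  rw [dist_comm _ x₀, dist_comm p, dist_comm q] at h2
  have h3 := hφ.sub_le_dist x₀ (η (1 / 2))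
  have h4 := hφ.sub_le_dist x₀ p
  have h5 := hφ.sub_le_dist x₀ q
  rw [hφ0] at h3 h4 h5
  exact hX.eq_of_dist_midpoint_eq (x := x₀) (t := t) hη (by linarith) (by linarith) (by linarith)

end Busemann

/-- Given a horofunction `φ` based at `x₀` with `φ x₀ = 0` on a proper Busemann space,
there is a unique ray `c` with `c 0 = x₀` such that for every `t > 0`, `φ (c t) = -t`
and `c t` is the unique minimizer of `φ` on the closed ball of radius `t` about `x₀`. -/
theorem horofunction_ray_exists_unique {X : Type*} [MetricSpace X] [ProperSpace X]
    (hX : IsBusemannSpace X) (x₀ : X) (φ : X → ℝ)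
    (hφ : IsHorofunction x₀ φ) (hφ0 : φ x₀ = 0) :
    ∃ c : ℝ → X, IsRay c ∧ c 0 = x₀ ∧
      (∀ t : ℝ, 0 < t → φ (c t) = -t ∧
        ∀ y : X, dist x₀ y ≤ t → y ≠ c t → -t < φ y) ∧
      ∀ c' : ℝ → X, IsRay c' → c' 0 = x₀ →
        (∀ t : ℝ, 0 < t → φ (c' t) = -t ∧
          ∀ y : X, dist x₀ y ≤ t → y ≠ c' t → -t < φ y) →
        ∀ t : ℝ, 0 ≤ t → c' t = c t := by
  have : Nonempty X := ⟨x₀⟩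
  choose! c hc hφc using fun (t : ℝ) (ht : 0 ≤ t) => hφ.exists_le_neg hX ht
  have hdist : ∀ t, 0 ≤ t → dist x₀ (c t) = t := fun t ht => by
    have h1 := hφ.sub_le_dist x₀ (c t)
    linarith [hc t ht, hφc t ht]
  have hmono : ∀ s t, 0 ≤ s → s ≤ t → dist (c s) (c t) = t - s := by
    intro s t hs hst
    have ht := hs.trans hst
    obtain ⟨z, hz, hz'⟩ := hX.exists_point_at_dist x₀ (c t) hs (by rwa [hdist t ht])
    rw [hdist t ht] at hz'
    have h1 := hφ.sub_le_dist z (c t)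
    have hzc : z = c s :=
      hφ.eq_of_le_neg hX hφ0 hz.le (by linarith [hφc t ht]) (hc s hs) (hφc s hs)
    rwa [← hzc]
  refine ⟨c, fun s t hs ht => ?_, ?_, fun t ht => ⟨?_, fun y hy hne => ?_⟩,
    fun c' hc' hc'0 hmin t ht => ?_⟩
  · rcases le_total s t with h | h
    · rw [hmono s t hs h, abs_sub_comm, abs_of_nonneg (by linarith)]
    · rw [dist_comm, hmono t s ht h, abs_of_nonneg (by linarith)]
  · exact (dist_eq_zero.1 (hdist 0 le_rfl)).symm
  · have h1 := hφ.sub_le_dist x₀ (c t)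
    linarith [hc t ht.le, hφc t ht.le]
  · by_contra! h
    exact hne (hφ.eq_of_le_neg hX hφ0 hy h (hc t ht.le) (hφc t ht.le))
  · have h1 := hc' 0 t le_rfl ht
    rw [hc'0, zero_sub, abs_neg, abs_of_nonneg ht] at h1
    refine hφ.eq_of_le_neg hX hφ0 h1.le ?_ (hc t ht) (hφc t ht)
    rcases ht.eq_or_lt with rfl | ht
    · simp [hc'0, hφ0]
    · exact (hmin t ht).1.le
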